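/- For A = ℤ[C₂], the integral group algebra of the cyclic group of order 2, the first homology of the partial complex, H₁ = ker ∂₁ / im ∂₂, is isomorphic as an abelian group to ℤ/2ℤ ⊕ ℤ/2ℤ; that is, HS₁(ℤ[C₂]) ≅ ℤ/2ℤ ⊕ ℤ/2ℤ. -/

import Mathlib

open TensorProduct

set_option synthInstance.maxHeartbeats 1000000
set_option maxHeartbeats 1000000

/-- The algebra `A = ℤ[C2]`, the integral group algebra of the cyclic group
of order 2. -/
abbrev A : Type := MonoidAlgebra ℤ (Multiplicative (ZMod 2))

/-- The group element `x` of `C₂`, viewed in `ℤ[C₂]`. -/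
noncomputable abbrev grp (x : Multiplicative (ZMod 2)) : A :=
  MonoidAlgebra.of ℤ (Multiplicative (ZMod 2)) x

/-- A basis over `ℤ` of a module remains a basis for the canonical `ℤ`-module structure. -/
noncomputable def intBasis {ι M : Type*} [AddCommGroup M] [Module ℤ M] (b : Module.Basis ι ℤ M) :
    @Module.Basis ι ℤ M _ _ (AddCommGroup.toIntModule M) :=
  @Module.Basis.ofRepr ι ℤ M _ _ (AddCommGroup.toIntModule M) b.repr.toAddEquiv.toIntLinearEquiv

/-- The basis of `ℤ[C₂]` consisting of the group elements. -/
noncomputable def grpBasis : Module.Basis (Multiplicative (ZMod 2)) ℤ A :=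
  intBasis (MonoidAlgebra.basis _ ℤ)

theorem grpBasis_apply (x : Multiplicative (ZMod 2)) : grpBasis x = grp x := rfl

/-- The basis of a tensor product of abelian groups given by tensors of basis elements. -/
noncomputable def intTensorBasis {ι κ M N : Type*} [AddCommGroup M] [AddCommGroup N]
    (b : Module.Basis ι ℤ M) (c : Module.Basis κ ℤ N) : Module.Basis (ι × κ) ℤ (M ⊗[ℤ] N) :=
  intBasis (b.tensorProduct c)

theorem intTensorBasis_apply {ι κ M N : Type*} [AddCommGroup M] [AddCommGroup N]
    (b : Module.Basis ι ℤ M) (c : Module.Basis κ ℤ N) (i : ι) (j : κ) :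
    intTensorBasis b c (i, j) = b i ⊗ₜ[ℤ] c j :=
  b.tensorProduct_apply c i j

/-- The basis of `ℤ[C₂]⊗ℤ[C₂]⊗ℤ[C₂]` consisting of tensors of group elements. -/
noncomputable def tripleBasis :
    Module.Basis (Multiplicative (ZMod 2) × Multiplicative (ZMod 2) × Multiplicative (ZMod 2)) ℤ
      (A ⊗[ℤ] (A ⊗[ℤ] A)) :=
  intTensorBasis grpBasis (intTensorBasis grpBasis grpBasis)

theorem tripleBasis_apply (x y z : Multiplicative (ZMod 2)) :
    tripleBasis (x, y, z) = grp x ⊗ₜ[ℤ] (grp y ⊗ₜ[ℤ] grp z) := by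
  rw [tripleBasis, intTensorBasis_apply, intTensorBasis_apply]
  rfl

/-- The class in `HS₁(ℤ[C₂]) ≅ ℤ/2 ⊕ ℤ/2` of a tensor of group elements. -/
def tripleClass (x y z : ZMod 2) : ZMod 2 × ZMod 2 :=
  (x * z * (1 - y) + y * z * (1 - x) + x * y * (1 - z), x * y * z)

/-- The linear extension of `tripleClass`. -/
noncomputable def classMap : A ⊗[ℤ] (A ⊗[ℤ] A) →ₗ[ℤ] ZMod 2 × ZMod 2 :=
  tripleBasis.constr ℤ fun p => tripleClass p.1.toAdd p.2.1.toAdd p.2.2.toAdd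

theorem classMap_grp (x y z : Multiplicative (ZMod 2)) :
    classMap (grp x ⊗ₜ[ℤ] (grp y ⊗ₜ[ℤ] grp z)) = tripleClass x.toAdd y.toAdd z.toAdd := by
  rw [← tripleBasis_apply, classMap, Module.Basis.constr_basis]

theorem classMap_grp_one (x z : Multiplicative (ZMod 2)) :
    classMap (grp x ⊗ₜ[ℤ] ((1 : A) ⊗ₜ[ℤ] grp z)) = tripleClass x.toAdd 0 z.toAdd := by
  rw [← map_one (MonoidAlgebra.of ℤ (Multiplicative (ZMod 2))), classMap_grp, toAdd_one]

theorem classMap_comp_boundary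
    (d₂ : ((A ⊗[ℤ] (A ⊗[ℤ] (A ⊗[ℤ] A))) × A) →ₗ[ℤ] A ⊗[ℤ] (A ⊗[ℤ] A))
    (h₂ : ∀ a b c d : A, d₂ (a ⊗ₜ[ℤ] (b ⊗ₜ[ℤ] (c ⊗ₜ[ℤ] d)), 0) =
      (a * b) ⊗ₜ[ℤ] (c ⊗ₜ[ℤ] d) + d ⊗ₜ[ℤ] ((c * a) ⊗ₜ[ℤ] b) +
        (b * c * a) ⊗ₜ[ℤ] ((1 : A) ⊗ₜ[ℤ] d) + d ⊗ₜ[ℤ] ((b * c) ⊗ₜ[ℤ] a))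
    (h₃ : ∀ a : A, d₂ (0, a) = (1 : A) ⊗ₜ[ℤ] (a ⊗ₜ[ℤ] (1 : A))) :
    classMap ∘ₗ d₂ = 0 := by
  have hl : (classMap ∘ₗ d₂).toAddMonoidHom.comp (AddMonoidHom.inl _ _) = 0 := by
    refine congrArg LinearMap.toAddMonoidHom ((intTensorBasis grpBasis tripleBasis).ext
      (f₁ := ((classMap ∘ₗ d₂).toAddMonoidHom.comp (AddMonoidHom.inl _ _)).toIntLinearMap)
      (f₂ := 0) ?_)
    rintro ⟨x, y, z, w⟩
    have h := h₂ (grp x) (grp y) (grp z) (grp w)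
    simp only [grp, ← map_mul] at h
    rw [intTensorBasis_apply, tripleBasis_apply, grpBasis_apply]
    change classMap (d₂ (_, 0)) = 0
    rw [h]
    simp only [map_add, classMap_grp, classMap_grp_one, toAdd_mul]
    generalize x.toAdd = x, y.toAdd = y, z.toAdd = z, w.toAdd = w
    revert x y z w
    decide
  have hr : (classMap ∘ₗ d₂).toAddMonoidHom.comp (AddMonoidHom.inr _ _) = 0 := by
    refine congrArg LinearMap.toAddMonoidHom (grpBasis.ext
      (f₁ := ((classMap ∘ₗ d₂).toAddMonoidHom.comp (AddMonoidHom.inr _ _)).toIntLinearMap)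
      (f₂ := 0) fun x => ?_)
    have h := h₃ (grp x)
    rw [← map_one (MonoidAlgebra.of ℤ (Multiplicative (ZMod 2)))] at h
    rw [grpBasis_apply]
    change classMap (d₂ (0, _)) = 0
    rw [h, classMap_grp, toAdd_one]
    generalize x.toAdd = x
    revert x
    decide
  refine LinearMap.ext fun ⟨t, a⟩ => ?_
  rw [← Prod.fst_add_snd (t, a), map_add]
  exact (congrArg₂ (· + ·) (DFunLike.congr_fun hl t) (DFunLike.congr_fun hr a)).trans (add_zero 0)

/-- The relations imposed by `∂₂` on the classes `f x y z` of tensors of group elements force all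
of these classes to be determined by two elements of order at most two. -/
theorem class_eq_of_relations {Q : Type*} [AddCommGroup Q] (f : ZMod 2 → ZMod 2 → ZMod 2 → Q)
    (hf : ∀ x y z w, f (x + y) z w + f w (z + x) y + f (y + z + x) 0 w + f w (y + z) x = 0)
    (h0 : ∀ x, f 0 x 0 = 0) :
    2 • f 1 0 1 = 0 ∧ 2 • f 1 1 1 = 0 ∧ ∀ x y z, f x y z =
      (tripleClass x y z).1.val • f 1 0 1 + (tripleClass x y z).2.val • f 1 1 1 := by
  have e : (1 : ZMod 2) + 1 = 0 := by decide
  have h000 := h0 0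
  have h010 := h0 1
  have r0010 := hf 0 0 1 0
  have r1000 := hf 1 0 0 0
  have r1011 := hf 1 0 1 1
  have r0011 := hf 0 0 1 1
  have r0101 := hf 0 1 0 1
  have r0110 := hf 0 1 1 0
  simp only [add_zero, zero_add, e] at r0010 r1000 r1011 r0011 r0101 r0110
  have h100 : f 1 0 0 = 0 := by linear_combination (norm := module) r0010 - (3 : ℤ) • h010
  have h001 : f 0 0 1 = 0 := by
    linear_combination (norm := module) r1000 - (2 : ℤ) • h100 - h010
  have h111 : 2 • f 1 1 1 = 0 := by linear_combination (norm := module) r1011 - h100 - h001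
  have h110 : f 1 1 0 = - f 0 1 1 := by linear_combination (norm := module) r0110 - (2 : ℤ) • h000
  have h011' : f 0 1 1 = f 1 0 1 := by linear_combination (norm := module) (2 : ℤ) • h110 - r0011
  have h101 : 2 • f 1 0 1 = 0 := by linear_combination (norm := module) r0101 - h110 + h011'
  have h110' : f 1 1 0 = f 1 0 1 := by linear_combination (norm := module) h110 - h011' - h101
  refine ⟨h101, h111, fun x y z => ?_⟩
  have zero_or_one (t : ZMod 2) : t = 0 ∨ t = 1 := by revert t; decide
  rcases zero_or_one x with rfl | rfl <;> rcases zero_or_one y with rfl | rfl <;>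
    rcases zero_or_one z with rfl | rfl <;>
    simp [tripleClass, ZMod.val_one, h000, h010, h100, h001, h011', h110']

theorem range_eq_ker_classMap
    (d₂ : ((A ⊗[ℤ] (A ⊗[ℤ] (A ⊗[ℤ] A))) × A) →ₗ[ℤ] A ⊗[ℤ] (A ⊗[ℤ] A))
    (h₂ : ∀ a b c d : A, d₂ (a ⊗ₜ[ℤ] (b ⊗ₜ[ℤ] (c ⊗ₜ[ℤ] d)), 0) =
      (a * b) ⊗ₜ[ℤ] (c ⊗ₜ[ℤ] d) + d ⊗ₜ[ℤ] ((c * a) ⊗ₜ[ℤ] b) +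
        (b * c * a) ⊗ₜ[ℤ] ((1 : A) ⊗ₜ[ℤ] d) + d ⊗ₜ[ℤ] ((b * c) ⊗ₜ[ℤ] a))
    (h₃ : ∀ a : A, d₂ (0, a) = (1 : A) ⊗ₜ[ℤ] (a ⊗ₜ[ℤ] (1 : A))) :
    LinearMap.range d₂ = LinearMap.ker classMap := by
  refine le_antisymm (LinearMap.range_le_ker_iff.2 (classMap_comp_boundary d₂ h₂ h₃)) ?_
  let π := (LinearMap.range d₂).mkQ
  have hπ (v) : π (d₂ v) = 0 :=
    (Submodule.Quotient.mk_eq_zero _).2 (LinearMap.mem_range_self d₂ v)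
  let f (x y z : ZMod 2) := π (grp (.ofAdd x) ⊗ₜ[ℤ] (grp (.ofAdd y) ⊗ₜ[ℤ] grp (.ofAdd z)))
  obtain ⟨hu, hv, hf⟩ := class_eq_of_relations f
    (fun x y z w => by
      have h := hπ (grp (.ofAdd x) ⊗ₜ[ℤ] (grp (.ofAdd y) ⊗ₜ[ℤ]
        (grp (.ofAdd z) ⊗ₜ[ℤ] grp (.ofAdd w))), 0)
      rw [h₂] at h
      simpa only [grp, f, ofAdd_add, ofAdd_zero, map_mul, map_add, map_one] using h)
    (fun x => by
      have h := hπ (0, grp (.ofAdd x))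
      rw [h₃] at h
      simpa only [f, grp, ofAdd_zero, map_one] using h)
  let s : ZMod 2 × ZMod 2 →+ (A ⊗[ℤ] (A ⊗[ℤ] A)) ⧸ LinearMap.range d₂ :=
    (ZMod.lift 2 ⟨zmultiplesHom _ (f 1 0 1), by rw [zmultiplesHom_apply]; exact_mod_cast hu⟩).coprod
      (ZMod.lift 2 ⟨zmultiplesHom _ (f 1 1 1), by rw [zmultiplesHom_apply]; exact_mod_cast hv⟩)
  have hs : s.toIntLinearMap ∘ₗ classMap = π := by
    refine tripleBasis.ext ?_
    rintro ⟨x, y, z⟩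
    have lift_eq (u) (hu) (t : ZMod 2) : ZMod.lift 2 ⟨zmultiplesHom
        ((A ⊗[ℤ] (A ⊗[ℤ] A)) ⧸ LinearMap.range d₂) u, hu⟩ t = t.val • u := by
      have ht : t = ((t.val : ℤ) : ZMod 2) := by simp
      refine (congrArg _ ht).trans ?_
      rw [ZMod.lift_coe, zmultiplesHom_apply, natCast_zsmul]
    have h := hf x.toAdd y.toAdd z.toAdd
    rw [tripleBasis_apply, LinearMap.comp_apply, classMap_grp]
    simp only [AddMonoidHom.coe_toIntLinearMap, s, AddMonoidHom.coprod_apply, lift_eq]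
    exact h.symm
  intro v hv
  rw [← Submodule.Quotient.mk_eq_zero]
  change π v = 0
  rw [← hs, LinearMap.comp_apply, LinearMap.mem_ker.1 hv, map_zero]

theorem classMap_surjective : Function.Surjective classMap := by
  intro p
  have h : ∀ p : ZMod 2 × ZMod 2,
      p = p.1.val • tripleClass 1 0 1 + p.2.val • tripleClass 1 1 1 := by decide
  refine ⟨p.1.val • tripleBasis (.ofAdd 1, .ofAdd 0, .ofAdd 1) +
    p.2.val • tripleBasis (.ofAdd 1, .ofAdd 1, .ofAdd 1), ?_⟩
  rw [map_add, map_nsmul, map_nsmul, tripleBasis_apply, tripleBasis_apply, classMap_grp,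
    classMap_grp]
  exact (h p).symm

/-- HS₁(ℤ[C₂]) ≅ ℤ/2ℤ ⊕ ℤ/2ℤ: the first homology `ker ∂₁ / im ∂₂` of the partial complex is isomorphic as an abelian group to `ℤ/2ℤ ⊕ ℤ/2ℤ`. -/
theorem HS1_int_C2
    (d₁ : A ⊗[ℤ] (A ⊗[ℤ] A) →ₗ[ℤ] A)
    (d₂ : ((A ⊗[ℤ] (A ⊗[ℤ] (A ⊗[ℤ] A))) × A) →ₗ[ℤ] A ⊗[ℤ] (A ⊗[ℤ] A))
    (h₁ : ∀ a b c : A, d₁ (a ⊗ₜ[ℤ] (b ⊗ₜ[ℤ] c)) = a * b * c - c * b * a)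
    (h₂ : ∀ a b c d : A, d₂ (a ⊗ₜ[ℤ] (b ⊗ₜ[ℤ] (c ⊗ₜ[ℤ] d)), 0) =
      (a * b) ⊗ₜ[ℤ] (c ⊗ₜ[ℤ] d) + d ⊗ₜ[ℤ] ((c * a) ⊗ₜ[ℤ] b) +
        (b * c * a) ⊗ₜ[ℤ] ((1 : A) ⊗ₜ[ℤ] d) + d ⊗ₜ[ℤ] ((b * c) ⊗ₜ[ℤ] a))
    (h₃ : ∀ a : A, d₂ (0, a) = (1 : A) ⊗ₜ[ℤ] (a ⊗ₜ[ℤ] (1 : A))) :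
    Nonempty
      ((↥(LinearMap.ker d₁) ⧸
          Submodule.comap (LinearMap.ker d₁).subtype (LinearMap.range d₂)) ≃+
        (ZMod 2 × ZMod 2)) := by
  have hd₁ : d₁ = 0 := by
    refine tripleBasis.ext ?_
    rintro ⟨x, y, z⟩
    rw [tripleBasis_apply, h₁, LinearMap.zero_apply, sub_eq_zero]
    ring
  have hker : LinearMap.ker d₁ = ⊤ := by rw [hd₁, LinearMap.ker_zero]
  let g : LinearMap.ker d₁ →ₗ[ℤ] ZMod 2 × ZMod 2 := classMap ∘ₗ (LinearMap.ker d₁).subtype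
  have hg : Function.Surjective g := fun p => by
    obtain ⟨v, hv⟩ := classMap_surjective p
    exact ⟨⟨v, hker ▸ Submodule.mem_top⟩, hv⟩
  have hgker : Submodule.comap (LinearMap.ker d₁).subtype (LinearMap.range d₂) =
      LinearMap.ker g := by
    rw [range_eq_ker_classMap d₂ h₂ h₃, LinearMap.ker_comp]
  exact ⟨((Submodule.quotEquivOfEq _ _ hgker).trans
    (g.quotKerEquivOfSurjective hg)).toAddEquiv⟩
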